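/- arXiv:1312.6714 — 3 statements merged into one kernel-verified Lean document; each statement's English description precedes it below -/
import Mathlib

section
/- For every σ ≥ 1 there exists a constant C > 0 depending only on p and σ such that for every σ-quasi-uniform partition of [a,b], every piecewise polynomial u^R = (P₀,…,P_N) of degree ≤ p with respect to it, and every function u that is (p+1)-times continuously differentiable on [a,b], one has ‖u − u^R‖_{L²(a,b)} ≥ C h^{p+1} ( ( Σ_{i=1}^{N} h ‖D_i‖² )^{1/2} − |u|_{H^{p+1}} ). -/
open MeasureTheory

noncomputable section

/-- Maximal mesh size `h` of the partition `x 0 < x 1 < ... < x (N+1)`. -/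
def meshH (N : ℕ) (x : ℕ → ℝ) : ℝ :=
  (Finset.range (N + 1)).sup' (Finset.nonempty_range_iff.mpr (Nat.succ_ne_zero N))
    (fun i => x (i + 1) - x i)

/-- Minimal mesh size `h_min`. -/
def meshHmin (N : ℕ) (x : ℕ → ℝ) : ℝ :=
  (Finset.range (N + 1)).inf' (Finset.nonempty_range_iff.mpr (Nat.succ_ne_zero N))
    (fun i => x (i + 1) - x i)

/-- Jump of the `k`-th derivative of the piecewise polynomial `P` at the node `x i`. -/
def jumpD (P : ℕ → Polynomial ℝ) (x : ℕ → ℝ) (i k : ℕ) : ℝ :=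
  (Polynomial.derivative^[k] (P i)).eval (x i)
    - (Polynomial.derivative^[k] (P (i - 1))).eval (x i)

/-- Euclidean norm of the scaled jump vector `D_i = (J_i^(k) / h^(p+1-k))_{k=0}^p`. -/
def normD (p N : ℕ) (x : ℕ → ℝ) (P : ℕ → Polynomial ℝ) (i : ℕ) : ℝ :=
  Real.sqrt (∑ k ∈ Finset.range (p + 1),
    (jumpD P x i k / meshH N x ^ (p + 1 - k)) ^ 2)

/-- `L²` distance between `u` and the piecewise polynomial `u^R` defined by `P`. -/
def distL2 (N : ℕ) (x : ℕ → ℝ) (P : ℕ → Polynomial ℝ) (u : ℝ → ℝ) : ℝ :=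
  Real.sqrt (∑ i ∈ Finset.range (N + 1),
    ∫ t in (x i)..(x (i + 1)), (u t - (P i).eval t) ^ 2)

/-- Sobolev seminorm `|u|_{H^{p+1}}` on `(a,b)`. -/
def semiH (p : ℕ) (a b : ℝ) (u : ℝ → ℝ) : ℝ :=
  Real.sqrt (∫ t in a..b, (iteratedDerivWithin (p + 1) u (Set.Icc a b) t) ^ 2)


lemma aux_cs (f : ℝ → ℝ) (hf : ContinuousOn f (Set.Icc 0 1)) (t : ℝ) (ht : t ∈ Set.Icc (0:ℝ) 1) :
    (∫ s in (0:ℝ)..t, f s) ^ 2 ≤ ∫ s in (0:ℝ)..1, f s ^ 2 := by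
  set m := ∫ s in (0:ℝ)..t, f s with hm
  have hsub : Set.uIcc 0 t ⊆ Set.Icc (0:ℝ) 1 := by
    rw [Set.uIcc_of_le ht.1]; exact Set.Icc_subset_Icc_right ht.2
  have hft : ContinuousOn f (Set.uIcc 0 t) := hf.mono hsub
  have i1 : IntervalIntegrable f volume 0 t := hft.intervalIntegrable
  have i2 : IntervalIntegrable (fun s => f s ^ 2) volume 0 t := (hft.pow 2).intervalIntegrable
  have h0 : 0 ≤ ∫ s in (0:ℝ)..t, (f s - m) ^ 2 :=
    intervalIntegral.integral_nonneg ht.1 (fun _ _ => sq_nonneg _)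
  have h1 : ∫ s in (0:ℝ)..t, (f s - m) ^ 2 = (∫ s in (0:ℝ)..t, f s ^ 2) - 2 * m * m + t * m ^ 2 := by
    have : (fun s => (f s - m) ^ 2) = fun s => (f s ^ 2 - 2 * m * f s) + m ^ 2 := by
      ext s; ring
    rw [this, intervalIntegral.integral_add (i2.sub (i1.const_mul _)) (by simp),
      intervalIntegral.integral_sub i2 (i1.const_mul _), intervalIntegral.integral_const_mul]
    simp [← hm]
  have h2 : ∫ s in (0:ℝ)..t, f s ^ 2 ≤ ∫ s in (0:ℝ)..1, f s ^ 2 := by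
    apply intervalIntegral.integral_mono_interval le_rfl ht.1 ht.2
    · exact Filter.Eventually.of_forall (fun _ => sq_nonneg _)
    · apply ContinuousOn.intervalIntegrable
      rw [Set.uIcc_of_le zero_le_one]; exact hf.pow 2
  nlinarith [ht.2, sq_nonneg m]

lemma aux_taylor (p : ℕ) : ∀ (G : ℕ → ℝ → ℝ),
    (∀ k ≤ p, ∀ t ∈ Set.Icc (0:ℝ) 1, HasDerivWithinAt (G k) (G (k+1) t) (Set.Icc 0 1) t) →
    ContinuousOn (G (p+1)) (Set.Icc 0 1) → ∀ t ∈ Set.Icc (0:ℝ) 1,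
    |G 0 t - ∑ k ∈ Finset.range (p+1), G k 0 / (k.factorial : ℝ) * t ^ k| ≤
      Real.sqrt (∫ s in (0:ℝ)..1, G (p+1) s ^ 2) := by
  induction p with
  | zero =>
    intro G hG hc t ht
    have h := aux_cs (G 1) hc t ht
    have e : ∫ s in (0:ℝ)..t, G 1 s = G 0 t - G 0 0 := by
      apply intervalIntegral.integral_eq_sub_of_hasDerivAt_of_le ht.1
      · intro s hs
        exact ((hG 0 le_rfl s ⟨hs.1, hs.2.trans ht.2⟩).continuousWithinAt).mono
          (Set.Icc_subset_Icc_right ht.2)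
      · intro s hs
        exact (hG 0 le_rfl s ⟨hs.1.le, hs.2.le.trans ht.2⟩).hasDerivAt
          (Icc_mem_nhds hs.1 (hs.2.trans_le ht.2))
      · apply ContinuousOn.intervalIntegrable
        rw [Set.uIcc_of_le ht.1]; exact hc.mono (Set.Icc_subset_Icc_right ht.2)
    rw [e] at h
    simpa using Real.abs_le_sqrt h
  | succ p ih =>
    intro G hG hc t ht
    have h := ih (fun k => G (k+1)) (fun k hk => hG (k+1) (by omega)) hc
    set M := Real.sqrt (∫ s in (0:ℝ)..1, G (p+1+1) s ^ 2)
    have key := norm_image_sub_le_of_norm_deriv_le_segment' (a := 0) (b := 1) (C := M)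
      (f := fun t => G 0 t - ∑ k ∈ Finset.range (p+1+1), G k 0 / (k.factorial : ℝ) * t ^ k)
      (f' := fun t => G 1 t - ∑ k ∈ Finset.range (p+1), G (k+1) 0 / (k.factorial : ℝ) * t ^ k)
      (by
        intro s hs
        refine (hG 0 (by omega) s hs).sub ?_
        have : ∑ k ∈ Finset.range (p+1), G (k+1) 0 / (k.factorial : ℝ) * s ^ k
            = ∑ k ∈ Finset.range (p+1+1), G k 0 / (k.factorial : ℝ) * (k * s ^ (k-1)) := by
          rw [Finset.sum_range_succ' _ (p+1)]
          simp only [Nat.cast_zero, zero_mul, mul_zero, add_zero, Nat.add_sub_cancel]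
          refine Finset.sum_congr rfl fun k _ => ?_
          rw [Nat.factorial_succ]
          have : (k.factorial : ℝ) ≠ 0 := by positivity
          push_cast
          field_simp
        rw [this]
        apply HasDerivWithinAt.fun_sum
        intro k _
        exact ((hasDerivAt_pow k s).const_mul _).hasDerivWithinAt)
      (fun s hs => by simpa using h s ⟨hs.1, hs.2.le⟩) t ht
    have z : ∑ k ∈ Finset.range (p+1+1), G k 0 / (k.factorial : ℝ) * (0:ℝ) ^ k = G 0 0 := by
      rw [Finset.sum_range_succ']; simp
    simp only [z, sub_self, sub_zero, Real.norm_eq_abs] at key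
    refine key.trans ?_
    have : 0 ≤ M := Real.sqrt_nonneg _
    nlinarith [ht.2]

lemma aux_inv (p : ℕ) : ∃ K : ℝ, 0 < K ∧ ∀ c : ℕ → ℝ, ∀ k ≤ p,
    c k ^ 2 ≤ K * ∫ t in (0:ℝ)..1, (∑ j ∈ Finset.range (p+1), c j * t ^ j) ^ 2 := by
  let F : (Fin (p+1) → ℝ) → ℝ := fun c => ∫ t in (0:ℝ)..1, (∑ j : Fin (p+1), c j * t ^ (j:ℕ)) ^ 2
  have hF : Continuous F := by
    apply intervalIntegral.continuous_parametric_intervalIntegral_of_continuous'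
    simp only [Function.uncurry_def]
    fun_prop
  have hpos : ∀ c, c ≠ 0 → 0 < F c := by
    intro c hc
    let Q : Polynomial ℝ := ∑ j : Fin (p+1), Polynomial.monomial (j:ℕ) (c j)
    have hQe : ∀ t, Q.eval t = ∑ j : Fin (p+1), c j * t ^ (j:ℕ) := by
      intro t; simp [Q, Polynomial.eval_finsetSum]
    have hQ : Q ≠ 0 := by
      intro h0
      apply hc
      ext k
      have : Q.coeff k = c k := by
        simp [Q, Polynomial.coeff_monomial, Fin.val_inj]
      rw [← this, h0]; simp
    obtain ⟨t, ht, hne⟩ : ∃ t ∈ Set.Icc (0:ℝ) 1, Q.eval t ≠ 0 := by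
      by_contra! hall
      apply hQ
      apply Polynomial.eq_zero_of_infinite_isRoot
      exact (Set.Icc_infinite (zero_lt_one (α := ℝ))).mono (fun t ht => hall t ht)
    apply intervalIntegral.integral_pos zero_lt_one
    · fun_prop
    · intro x _; positivity
    · refine ⟨t, ht, ?_⟩
      rw [← hQe]; positivity
  have hhom : ∀ (a : ℝ) c, F (a • c) = a ^ 2 * F c := by
    intro a c
    simp only [F]
    rw [← intervalIntegral.integral_const_mul]
    congr 1; ext t
    rw [← mul_pow, Finset.mul_sum]
    simp [mul_assoc]
  have hne : (Metric.sphere (0 : Fin (p+1) → ℝ) 1).Nonempty := NormedSpace.sphere_nonempty.2 zero_le_one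
  obtain ⟨c0, hc0, hmin⟩ := (isCompact_sphere (0 : Fin (p+1) → ℝ) 1).exists_isMinOn hne hF.continuousOn
  have hc0' : c0 ≠ 0 := by
    intro h; simp [h] at hc0
  have hp0 := hpos c0 hc0'
  refine ⟨(F c0)⁻¹, by positivity, ?_⟩
  intro c k hk
  let d : Fin (p+1) → ℝ := fun j => c j
  have hd : ∫ t in (0:ℝ)..1, (∑ j ∈ Finset.range (p+1), c j * t ^ j) ^ 2 = F d := by
    simp only [F, d, Finset.sum_range]
  rw [hd]
  have hle : |c k| ≤ ‖d‖ := norm_le_pi_norm d ⟨k, by omega⟩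
  by_cases hz : d = 0
  · have h1 : c k = 0 := by simpa [hz] using hle
    have h2 : F d = 0 := by simpa [hz] using hhom 0 0
    simp [h1, h2]
  · have hn : 0 < ‖d‖ := norm_pos_iff.2 hz
    have h1 : F c0 ≤ F (‖d‖⁻¹ • d) := hmin (by simp [norm_smul, hn.ne'])
    rw [hhom] at h1
    have h2 : ‖d‖ ^ 2 * F c0 ≤ F d := by
      calc _ ≤ ‖d‖ ^ 2 * (‖d‖⁻¹ ^ 2 * F d) := by gcongr
        _ = F d := by field_simp
    have h3 : c k ^ 2 ≤ ‖d‖ ^ 2 := by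
      rw [← sq_abs]; gcongr
    rw [inv_mul_eq_div, le_div_iff₀ hp0]
    nlinarith

lemma aux_side (p : ℕ) : ∃ K : ℝ, 0 < K ∧ ∀ (G : ℕ → ℝ → ℝ) (q : ℕ → ℝ),
    (∀ k ≤ p, ∀ t ∈ Set.Icc (0:ℝ) 1, HasDerivWithinAt (G k) (G (k+1) t) (Set.Icc 0 1) t) →
    ContinuousOn (G (p+1)) (Set.Icc 0 1) → ∀ k ≤ p,
    (q k - G k 0 / (k.factorial : ℝ)) ^ 2 ≤ K *
      ((∫ t in (0:ℝ)..1, (G 0 t - ∑ j ∈ Finset.range (p+1), q j * t ^ j) ^ 2) +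
        ∫ t in (0:ℝ)..1, G (p+1) t ^ 2) := by
  obtain ⟨K, hK, h⟩ := aux_inv p
  refine ⟨2 * K, by positivity, ?_⟩
  intro G q hG hc k hk
  refine (h (fun j => q j - G j 0 / (j.factorial : ℝ)) k hk).trans ?_
  set A := ∫ t in (0:ℝ)..1, G (p+1) t ^ 2 with hA
  have hA0 : 0 ≤ A := intervalIntegral.integral_nonneg zero_le_one (fun _ _ => sq_nonneg _)
  have hc0 : ContinuousOn (G 0) (Set.Icc 0 1) := fun t ht => (hG 0 (by omega) t ht).continuousWithinAt
  have i1 : IntervalIntegrable (fun t => (G 0 t - ∑ j ∈ Finset.range (p+1), q j * t ^ j) ^ 2) volume 0 1 := by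
    apply ContinuousOn.intervalIntegrable
    rw [Set.uIcc_of_le zero_le_one]; fun_prop
  have : ∫ t in (0:ℝ)..1, (∑ j ∈ Finset.range (p+1), (q j - G j 0 / (j.factorial : ℝ)) * t ^ j) ^ 2
      ≤ ∫ t in (0:ℝ)..1, (2 * (G 0 t - ∑ j ∈ Finset.range (p+1), q j * t ^ j) ^ 2 + 2 * A) := by
    apply intervalIntegral.integral_mono_on zero_le_one
    · apply Continuous.intervalIntegrable; fun_prop
    · exact (i1.const_mul 2).add (by simp)
    · intro t ht
      have h1 := aux_taylor p G hG hc t ht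
      rw [← hA] at h1
      have h2 : (G 0 t - ∑ k ∈ Finset.range (p+1), G k 0 / (k.factorial : ℝ) * t ^ k) ^ 2 ≤ A := by
        rw [← sq_abs, ← Real.sq_sqrt hA0]; gcongr
      simp only [sub_mul, Finset.sum_sub_distrib]
      nlinarith [sq_nonneg ((G 0 t - ∑ j ∈ Finset.range (p+1), q j * t ^ j) + (G 0 t - ∑ k ∈ Finset.range (p+1), G k 0 / (k.factorial : ℝ) * t ^ k))]
  rw [intervalIntegral.integral_add (i1.const_mul 2) (by simp), intervalIntegral.integral_const_mul] at this
  simp at this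
  nlinarith

lemma aux_polytaylor (P : Polynomial ℝ) (p : ℕ) (hP : P.natDegree ≤ p) (y c t : ℝ) :
    P.eval (y + c * t) = ∑ j ∈ Finset.range (p+1),
      ((Polynomial.derivative^[j] P).eval y * c ^ j / (j.factorial : ℝ)) * t ^ j := by
  rw [add_comm, ← Polynomial.taylor_eval, Polynomial.eval_eq_sum_range' (n := p+1)
    (by rw [Polynomial.natDegree_taylor]; omega)]
  refine Finset.sum_congr rfl fun j _ => ?_
  rw [Polynomial.taylor_coeff, ← Polynomial.factorial_smul_hasseDeriv]
  have : (j.factorial : ℝ) ≠ 0 := by positivity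
  simp
  field_simp
  ring

lemma aux_node (p : ℕ) : ∃ K : ℝ, 0 < K ∧ ∀ (a b : ℝ), a < b → ∀ (u : ℝ → ℝ),
    ContDiffOn ℝ (p + 1 : ℕ) u (Set.Icc a b) → ∀ (P : Polynomial ℝ), P.natDegree ≤ p →
    ∀ y c : ℝ, c ≠ 0 → y ∈ Set.Icc a b → y + c ∈ Set.Icc a b → ∀ k ≤ p,
    ((Polynomial.derivative^[k] P).eval y - iteratedDerivWithin k u (Set.Icc a b) y) ^ 2 * c ^ (2*k)
      ≤ K * ((c⁻¹ * ∫ t in y..(y+c), (u t - P.eval t) ^ 2) +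
        c ^ (2*p+2) * (c⁻¹ * ∫ t in y..(y+c), (iteratedDerivWithin (p+1) u (Set.Icc a b) t) ^ 2)) := by
  obtain ⟨K, hK, h⟩ := aux_side p
  refine ⟨K * (p.factorial : ℝ) ^ 2, by positivity, ?_⟩
  intro a b hab u hu P hP y c hc hy hyc k hk
  have hmap : Set.MapsTo (fun t => y + c * t) (Set.Icc (0:ℝ) 1) (Set.Icc a b) := by
    intro t ht
    have := (convex_Icc a b).add_smul_mem hy hyc ht
    simpa [mul_comm] using this
  have hud : UniqueDiffOn ℝ (Set.Icc a b) := uniqueDiffOn_Icc hab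
  have key := h (fun k t => c ^ k * iteratedDerivWithin k u (Set.Icc a b) (y + c * t))
    (fun j => (Polynomial.derivative^[j] P).eval y * c ^ j / (j.factorial : ℝ))
    (by
      intro j hj t ht
      have h1 : HasDerivWithinAt (iteratedDerivWithin j u (Set.Icc a b))
          (iteratedDerivWithin (j+1) u (Set.Icc a b) (y + c * t)) (Set.Icc a b) (y + c * t) := by
        rw [iteratedDerivWithin_succ]
        exact ((hu.differentiableOn_iteratedDerivWithin (by norm_cast; omega) hud) _
          (hmap ht)).hasDerivWithinAt
      have h2 : HasDerivWithinAt (fun t => y + c * t) c (Set.Icc 0 1) t := by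
        simpa using (((hasDerivAt_id t).const_mul c).const_add y).hasDerivWithinAt
      have h3 := (h1.comp t h2 hmap).const_mul (c ^ j)
      refine h3.congr_deriv ?_
      ring)
    (by
      apply ContinuousOn.mul continuousOn_const
      exact (hu.continuousOn_iteratedDerivWithin le_rfl hud).comp (by fun_prop) hmap) k hk
  simp only [iteratedDerivWithin_zero, pow_zero, one_mul, mul_pow, mul_zero, add_zero,
    ← aux_polytaylor P p hP y c] at key
  rw [intervalIntegral.integral_const_mul,
    intervalIntegral.integral_comp_add_mul (fun t => (u t - P.eval t) ^ 2) hc,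
    intervalIntegral.integral_comp_add_mul (fun t => (iteratedDerivWithin (p+1) u (Set.Icc a b) t) ^ 2) hc] at key
  simp only [mul_zero, add_zero, mul_one, smul_eq_mul] at key
  have e1 : (c ^ (p+1)) ^ 2 = c ^ (2*p+2) := by rw [← pow_mul]; ring_nf
  rw [e1] at key
  set R := ((c⁻¹ * ∫ t in y..(y+c), (u t - P.eval t) ^ 2) +
        c ^ (2*p+2) * (c⁻¹ * ∫ t in y..(y+c), (iteratedDerivWithin (p+1) u (Set.Icc a b) t) ^ 2))
  have hfk : (0:ℝ) < (k.factorial : ℝ) := by positivity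
  have e2 : ((Polynomial.derivative^[k] P).eval y * c ^ k / (k.factorial : ℝ) - c ^ k * iteratedDerivWithin k u (Set.Icc a b) y / (k.factorial : ℝ)) ^ 2 * (k.factorial : ℝ) ^ 2 = ((Polynomial.derivative^[k] P).eval y - iteratedDerivWithin k u (Set.Icc a b) y) ^ 2 * c ^ (2*k) := by
    rw [pow_mul']
    field_simp
  rw [← e2]
  have hKR : 0 ≤ K * R := (sq_nonneg _).trans key
  calc _ ≤ (K * R) * (k.factorial : ℝ) ^ 2 := by gcongr
    _ ≤ (K * R) * (p.factorial : ℝ) ^ 2 := by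
      gcongr
    _ = _ := by ring

lemma aux_jump (p : ℕ) : ∃ K : ℝ, 0 < K ∧ ∀ (a b : ℝ), a < b → ∀ (u : ℝ → ℝ),
    ContDiffOn ℝ (p + 1 : ℕ) u (Set.Icc a b) → ∀ (Pl Pr : Polynomial ℝ), Pl.natDegree ≤ p →
    Pr.natDegree ≤ p → ∀ l y m r : ℝ, 0 < r → a ≤ l → l ≤ y - r → y + r ≤ m → m ≤ b → ∀ k ≤ p,
    ((Polynomial.derivative^[k] Pr).eval y - (Polynomial.derivative^[k] Pl).eval y) ^ 2 * r ^ (2*k+1)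
      ≤ K * (((∫ t in l..y, (u t - Pl.eval t) ^ 2) + ∫ t in y..m, (u t - Pr.eval t) ^ 2) +
        r ^ (2*p+2) * ((∫ t in l..y, (iteratedDerivWithin (p+1) u (Set.Icc a b) t) ^ 2)
          + ∫ t in y..m, (iteratedDerivWithin (p+1) u (Set.Icc a b) t) ^ 2)) := by
  obtain ⟨K, hK, h⟩ := aux_node p
  refine ⟨2 * K, by positivity, ?_⟩
  intro a b hab u hu Pl Pr hPl hPr l y m r hr hal hly hym hmb k hk
  have hud : UniqueDiffOn ℝ (Set.Icc a b) := uniqueDiffOn_Icc hab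
  have h1 := h a b hab u hu Pr hPr y r hr.ne' ⟨by linarith, by linarith⟩ ⟨by linarith, by linarith⟩ k hk
  have h2 := h a b hab u hu Pl hPl y (-r) (by linarith) ⟨by linarith, by linarith⟩ ⟨by linarith, by linarith⟩ k hk
  have ev1 : (-r) ^ (2*k) = r ^ (2*k) := Even.neg_pow ⟨k, by ring⟩ r
  have ev2 : (-r) ^ (2*p+2) = r ^ (2*p+2) := Even.neg_pow ⟨p+1, by ring⟩ r
  rw [ev1, ev2, intervalIntegral.integral_symm, intervalIntegral.integral_symm (y + -r) y, inv_neg,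
    neg_mul_neg, neg_mul_neg, ← sub_eq_add_neg] at h2
  have hU := hu.continuousOn_iteratedDerivWithin le_rfl hud
  have hu0 := hu.continuousOn
  have left : ∀ f : ℝ → ℝ, ContinuousOn f (Set.Icc a b) →
      ∫ t in (y-r)..y, f t ^ 2 ≤ ∫ t in l..y, f t ^ 2 := by
    intro f hf
    apply intervalIntegral.integral_mono_interval hly (by linarith) le_rfl
    · exact Filter.Eventually.of_forall (fun _ => sq_nonneg _)
    · apply ContinuousOn.intervalIntegrable
      rw [Set.uIcc_of_le (by linarith)]
      exact (hf.mono (Set.Icc_subset_Icc (by linarith) (by linarith))).pow 2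
  have right : ∀ f : ℝ → ℝ, ContinuousOn f (Set.Icc a b) →
      ∫ t in y..(y+r), f t ^ 2 ≤ ∫ t in y..m, f t ^ 2 := by
    intro f hf
    apply intervalIntegral.integral_mono_interval le_rfl (by linarith) hym
    · exact Filter.Eventually.of_forall (fun _ => sq_nonneg _)
    · apply ContinuousOn.intervalIntegrable
      rw [Set.uIcc_of_le (by linarith)]
      exact (hf.mono (Set.Icc_subset_Icc (by linarith) (by linarith))).pow 2
  have l1 := left (fun t => u t - Pl.eval t) (hu0.sub Pl.continuous.continuousOn)
  have l2 := left _ hU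
  have r1 := right (fun t => u t - Pr.eval t) (hu0.sub Pr.continuous.continuousOn)
  have r2 := right _ hU
  set vr := (Polynomial.derivative^[k] Pr).eval y
  set vl := (Polynomial.derivative^[k] Pl).eval y
  set w := iteratedDerivWithin k u (Set.Icc a b) y
  have scale : ∀ z E A : ℝ, z * r ^ (2*k) ≤ K * (r⁻¹ * E + r ^ (2*p+2) * (r⁻¹ * A)) →
      z * r ^ (2*k+1) ≤ K * (E + r ^ (2*p+2) * A) := by
    intro z E A hz
    calc z * r ^ (2*k+1) = z * r ^ (2*k) * r := by ring
      _ ≤ K * (r⁻¹ * E + r ^ (2*p+2) * (r⁻¹ * A)) * r := by gcongr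
      _ = _ := by field_simp
  have s1 := scale _ _ _ h1
  have s2 := scale _ _ _ h2
  have hrk : 0 < r ^ (2*k+1) := by positivity
  have t1 := s1.trans (mul_le_mul_of_nonneg_left (add_le_add r1
    (mul_le_mul_of_nonneg_left r2 (by positivity : 0 ≤ r ^ (2*p+2)))) hK.le)
  have t2 := s2.trans (mul_le_mul_of_nonneg_left (add_le_add l1
    (mul_le_mul_of_nonneg_left l2 (by positivity : 0 ≤ r ^ (2*p+2)))) hK.le)
  have t3 : (vr - vl) ^ 2 * r ^ (2*k+1) ≤
      2 * ((vr - w) ^ 2 * r ^ (2*k+1)) + 2 * ((vl - w) ^ 2 * r ^ (2*k+1)) := by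
    have : (vr - vl) ^ 2 ≤ 2 * (vr - w) ^ 2 + 2 * (vl - w) ^ 2 := by
      nlinarith [sq_nonneg ((vr - w) + (vl - w))]
    calc _ ≤ (2 * (vr - w) ^ 2 + 2 * (vl - w) ^ 2) * r ^ (2*k+1) := by gcongr
      _ = _ := by ring
  linarith

lemma aux_scale (p k : ℕ) (hk : k ≤ p) (δ h z K E A : ℝ) (hδ : 0 < δ) (hδ1 : δ ≤ 1) (hh : 0 < h)
    (hK : 0 < K) (hE : 0 ≤ E) (hA : 0 ≤ A)
    (hz : z * (δ * h) ^ (2*k+1) ≤ K * (E + (δ * h) ^ (2*p+2) * A)) :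
    z * h ^ (2*k+1) ≤ K * ((δ ^ (2*p+1))⁻¹ * E + δ * (h ^ (2*p+2) * A)) := by
  obtain ⟨d, rfl⟩ := Nat.exists_eq_add_of_le hk
  have h1 : z * h ^ (2*k+1) ≤ (δ ^ (2*k+1))⁻¹ * (K * (E + (δ * h) ^ (2*(k+d)+2) * A)) := by
    rw [inv_mul_eq_div, le_div_iff₀ (by positivity)]
    refine le_trans (le_of_eq ?_) hz
    rw [mul_pow]; ring
  refine h1.trans ?_
  have e : (δ ^ (2*k+1))⁻¹ * (K * (E + (δ * h) ^ (2*(k+d)+2) * A)) =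
      K * ((δ ^ (2*k+1))⁻¹ * E + δ ^ (2*d+1) * (h ^ (2*(k+d)+2) * A)) := by
    rw [mul_pow, show 2*(k+d)+2 = (2*k+1) + (2*d+1) by ring, pow_add δ]
    field_simp
    ring
  rw [e]
  have a1 : (δ ^ (2*k+1))⁻¹ ≤ (δ ^ (2*(k+d)+1))⁻¹ := by
    apply inv_anti₀ (by positivity)
    exact pow_le_pow_of_le_one hδ.le hδ1 (by omega)
  have a2 : δ ^ (2*d+1) ≤ δ := by
    simpa using pow_le_pow_of_le_one hδ.le hδ1 (show 1 ≤ 2*d+1 by omega)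
  gcongr

/-- Theorem 2.6 (s = 2) in 1-D: on quasi-uniform meshes the `L²` error is bounded
below in terms of the scaled jumps `D_i`. -/
theorem l2_error_lower_bound_quasiuniform (p : ℕ) (σ : ℝ) (hσ : 1 ≤ σ) :
    ∃ C : ℝ, 0 < C ∧
      ∀ (N : ℕ), 1 ≤ N → ∀ (a b : ℝ), a < b →
      ∀ (x : ℕ → ℝ), x 0 = a → x (N + 1) = b → (∀ i ≤ N, x i < x (i + 1)) →
      meshH N x ≤ σ * meshHmin N x →
      ∀ (P : ℕ → Polynomial ℝ), (∀ i ≤ N, (P i).natDegree ≤ p) →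
      ∀ (u : ℝ → ℝ), ContDiffOn ℝ (p + 1 : ℕ) u (Set.Icc a b) →
      distL2 N x P u ≥
        C * meshH N x ^ (p + 1) *
          (Real.sqrt (∑ i ∈ Finset.Icc 1 N, meshH N x * (normD p N x P i) ^ 2)
            - semiH p a b u) := by
  obtain ⟨K, hK, hJ⟩ := aux_jump p
  set M : ℝ := 2 * ((p:ℝ)+1) * K with hM
  have hM0 : 0 < M := by positivity
  have hσ0 : 0 < σ := by linarith
  set δ : ℝ := min (1/σ) (1/M) with hδdef
  have hδ : 0 < δ := lt_min (by positivity) (by positivity)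
  have hδσ : δ * σ ≤ 1 := by
    have : δ ≤ 1/σ := min_le_left _ _
    rwa [le_div_iff₀ hσ0] at this
  have hδM : M * δ ≤ 1 := by
    have : δ ≤ 1/M := min_le_right _ _
    rw [le_div_iff₀ hM0] at this
    linarith
  have hδ1 : δ ≤ 1 := by nlinarith
  set L : ℝ := M * (δ ^ (2*p+1))⁻¹ with hL
  have hL0 : 0 < L := by positivity
  have hsL : 0 < Real.sqrt L := Real.sqrt_pos.2 hL0
  refine ⟨(Real.sqrt L)⁻¹, by positivity, ?_⟩
  intro N hN a b hab x hx0 hxN hx hq P hP u hu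
  set h := meshH N x with hh
  have hle : ∀ i ≤ N, x (i+1) - x i ≤ h := fun i hi =>
    Finset.le_sup' (fun i => x (i + 1) - x i) (Finset.mem_range.2 (by omega))
  have hge : ∀ i ≤ N, meshHmin N x ≤ x (i+1) - x i := fun i hi =>
    Finset.inf'_le (fun i => x (i + 1) - x i) (Finset.mem_range.2 (by omega))
  have hpos : 0 < h := by
    have := hle 0 (by omega)
    have := hx 0 (by omega)
    linarith
  have hr : ∀ i ≤ N, δ * h ≤ x (i+1) - x i := by
    intro i hi
    have h1 := hge i hi
    have h2 : 0 ≤ meshHmin N x := by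
      by_contra hneg
      push Not at hneg
      nlinarith
    calc δ * h ≤ δ * (σ * meshHmin N x) := by gcongr
      _ = (δ * σ) * meshHmin N x := by ring
      _ ≤ 1 * meshHmin N x := by gcongr
      _ ≤ _ := by linarith
  have hr0 : 0 < δ * h := by positivity
  have hxa : ∀ i ≤ N + 1, a ≤ x i := by
    intro i
    induction i with
    | zero => intro _; exact hx0.ge
    | succ i ih => intro hi; linarith [ih (by omega), hx i (by omega)]
  have hxb : ∀ j ≤ N + 1, x (N + 1 - j) ≤ b := by
    intro j
    induction j with
    | zero => intro _; exact hxN.le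
    | succ j ih =>
      intro hj
      have h1 := hx (N + 1 - (j+1)) (by omega)
      have h2 : N + 1 - (j+1) + 1 = N + 1 - j := by omega
      rw [h2] at h1
      linarith [ih (by omega)]
  have hxb' : ∀ i ≤ N + 1, x i ≤ b := by
    intro i hi
    have := hxb (N + 1 - i) (by omega)
    rwa [show N + 1 - (N + 1 - i) = i by omega] at this
  set U : ℝ → ℝ := iteratedDerivWithin (p+1) u (Set.Icc a b) with hUdef
  have hUc : ContinuousOn U (Set.Icc a b) :=
    hu.continuousOn_iteratedDerivWithin le_rfl (uniqueDiffOn_Icc hab)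
  set e : ℕ → ℝ := fun i => ∫ t in (x i)..(x (i + 1)), (u t - (P i).eval t) ^ 2 with he
  set α : ℕ → ℝ := fun i => ∫ t in (x i)..(x (i + 1)), U t ^ 2 with hα
  have he0 : ∀ i ≤ N, 0 ≤ e i := fun i hi =>
    intervalIntegral.integral_nonneg (hx i hi).le (fun _ _ => sq_nonneg _)
  have hα0 : ∀ i ≤ N, 0 ≤ α i := fun i hi =>
    intervalIntegral.integral_nonneg (hx i hi).le (fun _ _ => sq_nonneg _)
  have hαsum : ∑ i ∈ Finset.range (N+1), α i = ∫ t in a..b, U t ^ 2 := by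
    rw [← hx0, ← hxN]
    apply intervalIntegral.sum_integral_adjacent_intervals
    intro i hi
    apply ContinuousOn.intervalIntegrable
    rw [Set.uIcc_of_le (hx i (by omega)).le]
    exact (hUc.mono (Set.Icc_subset_Icc (hxa i (by omega)) (hxb' (i+1) (by omega)))).pow 2
  have two : ∀ f : ℕ → ℝ, (∀ i ≤ N, 0 ≤ f i) →
      ∑ i ∈ Finset.range N, (f i + f (i+1)) ≤ 2 * ∑ i ∈ Finset.range (N+1), f i := by
    intro f hf
    rw [Finset.sum_add_distrib]
    have h1 := Finset.sum_range_succ f N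
    have h2 := Finset.sum_range_succ' f N
    have h3 := hf 0 (by omega)
    have h4 := hf N le_rfl
    linarith
  have node : ∀ i < N, h ^ (2*p+2) * (h * (normD p N x P (i+1)) ^ 2) ≤
      ((p:ℝ)+1) * K * ((δ ^ (2*p+1))⁻¹ * (e i + e (i+1)) + δ * (h ^ (2*p+2) * (α i + α (i+1)))) := by
    intro i hi
    have hn : h ^ (2*p+2) * (h * (normD p N x P (i+1)) ^ 2) =
        ∑ k ∈ Finset.range (p+1), jumpD P x (i+1) k ^ 2 * h ^ (2*k+1) := by
      rw [normD, Real.sq_sqrt (Finset.sum_nonneg fun _ _ => sq_nonneg _), Finset.mul_sum,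
        Finset.mul_sum]
      refine Finset.sum_congr rfl fun k hk => ?_
      obtain ⟨d, rfl⟩ := Nat.exists_eq_add_of_le (Nat.lt_succ_iff.1 (Finset.mem_range.1 hk))
      rw [← hh, show k + d + 1 - k = d + 1 by omega, div_pow, ← pow_mul,
        show 2*(k+d)+2 = (d+1)*2 + 2*k by ring, pow_add]
      field_simp
      ring
    rw [hn]
    have hb : ∀ k ∈ Finset.range (p+1), jumpD P x (i+1) k ^ 2 * h ^ (2*k+1) ≤
        K * ((δ ^ (2*p+1))⁻¹ * (e i + e (i+1)) + δ * (h ^ (2*p+2) * (α i + α (i+1)))) := by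
      intro k hk
      have hk' : k ≤ p := Nat.lt_succ_iff.1 (Finset.mem_range.1 hk)
      apply aux_scale p k hk' δ h _ K _ _ hδ hδ1 hpos hK
        (add_nonneg (he0 i (by omega)) (he0 (i+1) (by omega)))
        (add_nonneg (hα0 i (by omega)) (hα0 (i+1) (by omega)))
      have h1 := hr i (by omega)
      have h2 := hr (i+1) (by omega)
      exact hJ a b hab u hu (P i) (P (i+1)) (hP i (by omega)) (hP (i+1) (by omega))
        (x i) (x (i+1)) (x (i+1+1)) (δ * h) hr0 (hxa i (by omega)) (by linarith) (by linarith)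
        (hxb' _ (by omega)) k hk'
    refine (Finset.sum_le_sum hb).trans (le_of_eq ?_)
    simp
    ring
  set D := ∑ i ∈ Finset.range (N+1), e i with hD
  set B := ∫ t in a..b, U t ^ 2 with hB
  have hD0 : 0 ≤ D := Finset.sum_nonneg fun i hi => he0 i (by have := Finset.mem_range.1 hi; omega)
  have hB0 : 0 ≤ B := intervalIntegral.integral_nonneg hab.le (fun _ _ => sq_nonneg _)
  set S := ∑ i ∈ Finset.Icc 1 N, h * (normD p N x P i) ^ 2 with hS
  have hSr : S = ∑ i ∈ Finset.range N, h * (normD p N x P (i+1)) ^ 2 := by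
    rw [hS, Finset.range_eq_Ico,
      Finset.sum_Ico_add' (fun i => h * (normD p N x P i) ^ 2) 0 N 1]
    rfl
  have main : h ^ (2*p+2) * S ≤ L * D + h ^ (2*p+2) * B := by
    have h1 : h ^ (2*p+2) * S ≤ ((p:ℝ)+1) * K * ((δ ^ (2*p+1))⁻¹ * (2 * D) + δ * (h ^ (2*p+2) * (2 * B))) := by
      rw [hSr, Finset.mul_sum]
      refine (Finset.sum_le_sum fun i hi => node i (Finset.mem_range.1 hi)).trans ?_
      rw [← Finset.mul_sum, Finset.sum_add_distrib, ← Finset.mul_sum, ← Finset.mul_sum,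
        ← Finset.mul_sum, ← hαsum]
      have t1 := two e he0
      have t2 := two α hα0
      gcongr
    have h2 : M * δ * (h ^ (2*p+2) * B) ≤ 1 * (h ^ (2*p+2) * B) := by gcongr
    calc _ ≤ _ := h1
      _ = L * D + M * δ * (h ^ (2*p+2) * B) := by rw [hL, hM]; ring
      _ ≤ _ := by linarith
  have hdist : distL2 N x P u = Real.sqrt D := rfl
  have hsemi : semiH p a b u = Real.sqrt B := rfl
  rw [hdist, hsemi, ge_iff_le, mul_assoc, inv_mul_le_iff₀ hsL, mul_sub, sub_le_iff_le_add]
  have hp2 : ∀ z, 0 ≤ z → h ^ (p+1) * Real.sqrt z = Real.sqrt (h ^ (2*p+2) * z) := by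
    intro z hz
    rw [Real.sqrt_mul (by positivity), show 2*p+2 = (p+1)*2 by ring, pow_mul,
      Real.sqrt_sq (by positivity)]
  have hS0 : 0 ≤ S := Finset.sum_nonneg fun i _ => by positivity
  rw [hp2 S hS0, hp2 B hB0, ← Real.sqrt_mul hL0.le]
  refine (Real.sqrt_le_sqrt main).trans ?_
  have q1 : 0 ≤ L * D := by positivity
  have q2 : 0 ≤ h ^ (2*p+2) * B := by positivity
  rw [Real.sqrt_le_left (by positivity), add_sq, Real.sq_sqrt q1, Real.sq_sqrt q2]
  have q3 : 0 ≤ 2 * Real.sqrt (L * D) * Real.sqrt (h ^ (2*p+2) * B) := by positivity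
  linarith

end
end

section
/- For every σ ≥ 1 there exists a constant C > 0 depending only on p and σ such that for every σ-quasi-uniform partition of [a,b], every piecewise polynomial u^R = (P₀,…,P_N) of degree ≤ p with respect to it, every function u that is (p+1)-times continuously differentiable on [a,b], every index 0 ≤ i ≤ N, every point x_m ∈ [x_i, x_{i+1}], and every 0 ≤ k ≤ p, one has |P_i^{(k)}(x_m) − u^{(k)}(x_m)| ≤ C h^{−k} ( h^{p+1} (1 + h^{−1/2}) (∫_{x_i}^{x_{i+1}} |u^{(p+1)}(x)|² dx)^{1/2} + h^{−1/2} (∫_{x_i}^{x_{i+1}} |u(x) − P_i(x)|² dx)^{1/2} ). -/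
open MeasureTheory

noncomputable section

lemma aux_coef (p : ℕ) : ∃ m : ℝ, 0 < m ∧ ∀ c : Fin (p+1) → ℝ, ∀ s ∈ Set.Icc (0:ℝ) 1,
    ∀ k, m * (c k)^2 ≤ ∫ r in (0:ℝ)..1, (∑ j, c j * (r - s)^(j:ℕ))^2 := by
  set f : (Fin (p+1) → ℝ) × ℝ → ℝ := fun q => ∫ r in (0:ℝ)..1, (∑ j, q.1 j * (r - q.2)^(j:ℕ))^2 with hf
  have hfc : Continuous f := by
    apply intervalIntegral.continuous_parametric_intervalIntegral_of_continuous'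
    simp only [Function.uncurry_def]
    fun_prop
  have hK : IsCompact (Metric.sphere (0 : Fin (p+1) → ℝ) 1 ×ˢ Set.Icc (0:ℝ) 1) :=
    (isCompact_sphere _ _).prod isCompact_Icc
  have hne : (Metric.sphere (0 : Fin (p+1) → ℝ) 1 ×ˢ Set.Icc (0:ℝ) 1).Nonempty :=
    Set.Nonempty.prod ((NormedSpace.sphere_nonempty).2 zero_le_one) ⟨0, by simp⟩
  obtain ⟨q, hq, hmin⟩ := hK.exists_isMinOn hne hfc.continuousOn
  have hpos : 0 < f q := by
    obtain ⟨h1, h2⟩ := hq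
    have hex : ∃ r ∈ Set.Icc (0:ℝ) 1, (∑ j, q.1 j * (r - q.2)^(j:ℕ)) ≠ 0 := by
      by_contra! hcon
      have hQ : (∑ j : Fin (p+1), Polynomial.C (q.1 j) * Polynomial.X ^ (j:ℕ)) = 0 := by
        apply Polynomial.eq_zero_of_infinite_isRoot
        apply Set.Infinite.mono _ (Set.Icc_infinite (show 0 - q.2 < 1 - q.2 by linarith))
        intro y hy
        have := hcon (y + q.2) ⟨by linarith [hy.1], by linarith [hy.2]⟩
        simpa [Polynomial.IsRoot, Polynomial.eval_finsetSum] using this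
      have h0 : q.1 = 0 := by
        ext k
        have := congrArg (fun P => Polynomial.coeff P (k:ℕ)) hQ
        simpa [Polynomial.finsetSum_coeff, Polynomial.coeff_X_pow, Fin.val_inj] using this
      rw [h0] at h1
      simp at h1
    obtain ⟨r, hr, hr0⟩ := hex
    apply intervalIntegral.integral_pos one_pos
    · fun_prop
    · intro x _; positivity
    · exact ⟨r, hr, by positivity⟩
  refine ⟨f q, hpos, fun c s hs k => ?_⟩
  by_cases hc : c = 0
  · subst hc; simp
  have hn : 0 < ‖c‖ := norm_pos_iff.2 hc
  have h1 := hmin (show ((‖c‖⁻¹ • c, s) : (Fin (p+1) → ℝ) × ℝ) ∈ _ from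
    ⟨by simp [norm_smul, hn.ne'], hs⟩)
  have h2 : f (‖c‖⁻¹ • c, s) = (‖c‖⁻¹)^2 * ∫ r in (0:ℝ)..1, (∑ j, c j * (r - s)^(j:ℕ))^2 := by
    rw [hf, ← intervalIntegral.integral_const_mul]
    apply intervalIntegral.integral_congr
    intro r _
    simp only [Pi.smul_apply, smul_eq_mul, mul_assoc, ← Finset.mul_sum, mul_pow]
  simp only [Set.mem_ofPred_eq] at h1
  rw [h2] at h1
  have h3 : (c k)^2 ≤ ‖c‖^2 := by
    rw [← sq_abs]
    exact pow_le_pow_left₀ (abs_nonneg _) (norm_le_pi_norm c k) 2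
  calc f q * (c k)^2 ≤ f q * ‖c‖^2 := by gcongr
    _ ≤ ((‖c‖⁻¹)^2 * ∫ r in (0:ℝ)..1, (∑ j, c j * (r - s)^(j:ℕ))^2) * ‖c‖^2 := by gcongr
    _ = _ := by field_simp

lemma aux_cs_s9 {c d : ℝ} (hcd : c < d) {v : ℝ → ℝ} (hv : ContinuousOn v (Set.Icc c d)) :
    (∫ t in c..d, |v t|)^2 ≤ (d - c) * ∫ t in c..d, (v t)^2 := by
  set S := ∫ t in c..d, |v t| with hS
  set l := d - c with hl
  have hl0 : 0 < l := by simp [hl, hcd]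
  have hv' : ContinuousOn v (Set.uIcc c d) := by rwa [Set.uIcc_of_le hcd.le]
  have i1 : IntervalIntegrable (fun t => (v t)^2) volume c d := (hv'.pow 2).intervalIntegrable
  have i2 : IntervalIntegrable (fun t => |v t|) volume c d := hv'.abs.intervalIntegrable
  have h0 : 0 ≤ ∫ t in c..d, ((v t)^2 - 2 * (S/l) * |v t| + (S/l)^2) := by
    apply intervalIntegral.integral_nonneg hcd.le
    intro t _
    nlinarith [sq_nonneg (|v t| - S/l), sq_abs (v t)]
  rw [intervalIntegral.integral_add (i1.sub (i2.const_mul _)) (by simp),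
    intervalIntegral.integral_sub i1 (i2.const_mul _), intervalIntegral.integral_const_mul,
    intervalIntegral.integral_const, ← hS, ← hl, smul_eq_mul] at h0
  have : l * ((∫ t in c..d, (v t)^2) - 2 * (S/l) * S + l * (S/l)^2)
    = l * (∫ t in c..d, (v t)^2) - S^2 := by field_simp; ring
  nlinarith [mul_nonneg hl0.le h0]

lemma aux_taylor_s9 (p : ℕ) {a b c d : ℝ} (hcd : c < d) (hac : a ≤ c) (hdb : d ≤ b) {f : ℝ → ℝ}
    (hf : ContDiffOn ℝ (p+1:ℕ) f (Set.Icc a b)) {y t : ℝ} (hy : y ∈ Set.Icc c d)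
    (ht : t ∈ Set.Icc c d) :
    (f t - taylorWithinEval f p (Set.Icc a b) y t)^2 ≤
      (d - c)^(2*p) * ((d - c) * ∫ r in c..d, (iteratedDerivWithin (p+1) f (Set.Icc a b) r)^2) := by
  have hab : a < b := by linarith
  have hsub : Set.Icc c d ⊆ Set.Icc a b := Set.Icc_subset_Icc hac hdb
  have hu := uniqueDiffOn_Icc hab
  set v := iteratedDerivWithin (p+1) f (Set.Icc a b) with hv
  have hvc : ContinuousOn v (Set.Icc a b) :=
    hf.continuousOn_iteratedDerivWithin (le_refl _) hu
  have hvcd := hvc.mono hsub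
  have hyt : Set.uIcc y t ⊆ Set.Icc c d := Set.uIcc_subset_Icc hy ht
  have hD : ∀ z ∈ Set.Icc a b, HasDerivWithinAt (fun y => taylorWithinEval f p (Set.Icc a b) y t)
      (((p.factorial : ℝ)⁻¹ * (t - z) ^ p) • v z) (Set.Icc a b) z := fun z hz =>
    hasDerivWithinAt_taylorWithinEval_at_Icc t hab hz (hf.of_le (by exact_mod_cast Nat.le_succ p))
      (hf.differentiableOn_iteratedDerivWithin (by exact_mod_cast Nat.lt_succ_self p) hu)
  have hint : ∫ z in y..t, ((p.factorial : ℝ)⁻¹ * (t - z) ^ p) • v z =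
      taylorWithinEval f p (Set.Icc a b) t t - taylorWithinEval f p (Set.Icc a b) y t := by
    apply intervalIntegral.integral_eq_sub_of_hasDeriv_right
      (f := fun y => taylorWithinEval f p (Set.Icc a b) y t)
      (f' := fun z => ((p.factorial : ℝ)⁻¹ * (t - z) ^ p) • v z)
    · intro z hz
      exact ((hD z (hsub (hyt hz))).continuousWithinAt).mono (hyt.trans hsub)
    · intro z hz
      have h1 : min y t ∈ Set.Icc c d := hyt (by simp [Set.uIcc])
      have h2 : max y t ∈ Set.Icc c d := hyt (by simp [Set.uIcc])
      have : HasDerivAt (fun y => taylorWithinEval f p (Set.Icc a b) y t)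
        (((p.factorial : ℝ)⁻¹ * (t - z) ^ p) • v z) z :=
        (hD z (hsub (hyt (Set.Ioo_subset_Icc_self hz)))).hasDerivAt
          (Icc_mem_nhds (by linarith [hz.1, h1.1]) (by linarith [hz.2, h2.2]))
      exact this.hasDerivWithinAt
    · apply ContinuousOn.intervalIntegrable
      exact ContinuousOn.smul (f := fun z => ((p.factorial : ℝ)⁻¹ * (t - z) ^ p)) (by fun_prop) (hvcd.mono hyt)
  rw [taylorWithinEval_self] at hint
  rw [← hint]
  have i2 : IntervalIntegrable (fun t => |v t|) volume c d := by
    apply ContinuousOn.intervalIntegrable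
    rw [Set.uIcc_of_le hcd.le]
    exact hvcd.abs
  have hb : |∫ z in y..t, ((p.factorial : ℝ)⁻¹ * (t - z) ^ p) • v z| ≤
      (d-c)^p * ∫ t in c..d, |v t| := by
    rw [← intervalIntegral.integral_const_mul]
    rw [← Real.norm_eq_abs]
    refine (intervalIntegral.norm_integral_le_integral_norm_uIoc).trans ?_
    rw [intervalIntegral.integral_of_le hcd.le]
    have hss : Set.uIoc y t ⊆ Set.Ioc c d := by
      intro z hz
      rw [Set.mem_uIoc] at hz
      rcases hz with h | h
      · exact ⟨by linarith [hy.1, h.1], by linarith [ht.2, h.2]⟩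
      · exact ⟨by linarith [ht.1, h.1], by linarith [hy.2, h.2]⟩
    have i3 : IntegrableOn (fun t => (d-c)^p * |v t|) (Set.Ioc c d) :=
      ((intervalIntegrable_iff_integrableOn_Ioc_of_le hcd.le).1 (i2.const_mul _))
    refine le_trans ?_ (setIntegral_mono_set i3 ?_ hss.eventuallyLE)
    · apply setIntegral_mono_on
      · apply Integrable.norm
        rw [← IntegrableOn, ← intervalIntegrable_iff]
        apply ContinuousOn.intervalIntegrable
        exact ContinuousOn.smul (f := fun z => ((p.factorial : ℝ)⁻¹ * (t - z) ^ p))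
          (by fun_prop) (hvcd.mono hyt)
      · exact i3.mono_set hss
      · exact measurableSet_uIoc
      · intro z hz
        have hz' := hss hz
        have hf1 : ((p.factorial : ℝ)⁻¹) ≤ 1 :=
          inv_le_one_of_one_le₀ (by exact_mod_cast Nat.succ_le_of_lt p.factorial_pos)
        rw [smul_eq_mul, Real.norm_eq_abs, abs_mul, abs_mul, abs_pow,
          abs_of_pos (show (0:ℝ) < (p.factorial : ℝ)⁻¹ by positivity)]
        have : |t - z| ≤ d - c := by
          rw [abs_le]; constructor <;> linarith [ht.1, ht.2, hz'.1, hz'.2]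
        calc (p.factorial : ℝ)⁻¹ * |t-z|^p * |v z| ≤ 1 * (d-c)^p * |v z| := by gcongr
          _ = _ := by ring
    · refine Filter.Eventually.of_forall fun z => ?_
      have : 0 ≤ d - c := by linarith
      simp only [Pi.zero_apply]
      positivity
  calc _ = |∫ z in y..t, ((p.factorial : ℝ)⁻¹ * (t - z) ^ p) • v z|^2 := (sq_abs _).symm
    _ ≤ ((d-c)^p * ∫ t in c..d, |v t|)^2 := by gcongr
    _ = (d-c)^(2*p) * (∫ t in c..d, |v t|)^2 := by ring
    _ ≤ _ := by
      have : 0 ≤ d - c := by linarith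
      gcongr
      exact aux_cs_s9 hcd hvcd

lemma aux_cd (Q : Polynomial ℝ) {n : WithTop ℕ∞} : ContDiff ℝ n (fun t => Q.eval t) := by
  simpa using Q.contDiff_aeval (𝕜 := ℝ) (n := n)

lemma aux_poly (Q : Polynomial ℝ) (k : ℕ) {a b t : ℝ} (hab : a < b) (ht : t ∈ Set.Icc a b) :
    iteratedDerivWithin k (fun t => Q.eval t) (Set.Icc a b) t =
      (Polynomial.derivative^[k] Q).eval t := by
  rw [iteratedDerivWithin_eq_iteratedDeriv (uniqueDiffOn_Icc hab) (aux_cd Q).contDiffAt ht]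
  clear ht
  induction k generalizing t with
  | zero => simp
  | succ k ih =>
    rw [iteratedDeriv_succ, Function.iterate_succ_apply']
    rw [show iteratedDeriv k (fun t => Q.eval t) = fun t => (Polynomial.derivative^[k] Q).eval t from funext fun t => ih]
    simp

lemma aux_local (p : ℕ) : ∃ m : ℝ, 0 < m ∧ ∀ {a b c d : ℝ} (hcd : c < d) (hac : a ≤ c)
    (hdb : d ≤ b) {w : ℝ → ℝ} (hw : ContDiffOn ℝ (p+1:ℕ) w (Set.Icc a b)) {y : ℝ}
    (hy : y ∈ Set.Icc c d) (k : ℕ) (hk : k ≤ p),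
    m * ((d-c)^k * (k.factorial : ℝ)⁻¹ * iteratedDerivWithin k w (Set.Icc a b) y)^2 ≤
      (d-c)⁻¹ * (2 * (∫ t in c..d, (w t)^2) + 2 * ((d-c)^(2*p+2) *
        ∫ r in c..d, (iteratedDerivWithin (p+1) w (Set.Icc a b) r)^2)) := by
  obtain ⟨m, hm, H⟩ := aux_coef p
  refine ⟨m, hm, ?_⟩
  intro a b c d hcd hac hdb w hw y hy k hk
  have hl : 0 < d - c := by linarith
  have hsub : Set.Icc c d ⊆ Set.Icc a b := Set.Icc_subset_Icc hac hdb
  have h1 := H (fun j => (d-c)^(j:ℕ) * ((j:ℕ).factorial : ℝ)⁻¹ *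
    iteratedDerivWithin j w (Set.Icc a b) y) ((y - c)/(d-c))
    ⟨div_nonneg (by linarith [hy.1]) hl.le, by rw [div_le_one hl]; linarith [hy.2]⟩
    ⟨k, by omega⟩
  simp only at h1
  refine h1.trans ?_
  have h2 : ∫ r in (0:ℝ)..1, (∑ j : Fin (p+1), (d-c)^(j:ℕ) * ((j:ℕ).factorial : ℝ)⁻¹ *
      iteratedDerivWithin j w (Set.Icc a b) y * (r - (y-c)/(d-c))^(j:ℕ))^2 =
      ∫ r in (0:ℝ)..1, (fun t => (taylorWithinEval w p (Set.Icc a b) y t)^2) ((d-c) * r + c) := by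
    apply intervalIntegral.integral_congr
    intro r _
    simp only
    rw [taylor_within_apply, Finset.sum_range]
    congr 1
    apply Finset.sum_congr rfl
    intro j _
    rw [show (d-c) * r + c - y = (d-c) * (r - (y-c)/(d-c)) by field_simp; ring, mul_pow,
      smul_eq_mul]
    ring
  rw [h2, intervalIntegral.integral_comp_mul_add
    (fun t => (taylorWithinEval w p (Set.Icc a b) y t)^2) hl.ne']
  rw [show (d-c) * 0 + c = c by ring, show (d-c) * 1 + c = d by ring, smul_eq_mul]
  gcongr
  set A := ∫ r in c..d, (iteratedDerivWithin (p+1) w (Set.Icc a b) r)^2 with hA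
  have iw : IntervalIntegrable (fun t => (w t)^2) volume c d := by
    apply ContinuousOn.intervalIntegrable
    rw [Set.uIcc_of_le hcd.le]
    exact (hw.continuousOn.mono hsub).pow 2
  have hT : Continuous (fun t => (taylorWithinEval w p (Set.Icc a b) y t)^2) := by
    simp only [taylor_within_apply]
    fun_prop
  calc ∫ t in c..d, (taylorWithinEval w p (Set.Icc a b) y t)^2 ≤
      ∫ t in c..d, (2 * (w t)^2 + 2 * ((d-c)^(2*p) * ((d-c) * A))) := by
        apply intervalIntegral.integral_mono_on hcd.le (hT.intervalIntegrable _ _)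
          ((iw.const_mul 2).add (by simp))
        intro t ht
        have := aux_taylor_s9 p hcd hac hdb hw hy ht
        rw [← hA] at this
        nlinarith [sq_nonneg (2 * w t - taylorWithinEval w p (Set.Icc a b) y t)]
    _ = _ := by
      rw [intervalIntegral.integral_add (iw.const_mul 2) (by simp),
        intervalIntegral.integral_const_mul, intervalIntegral.integral_const, smul_eq_mul]
      ring

lemma aux_final {p k : ℕ} (hk : k ≤ p) {m σ l h A W z : ℝ} (hm : 0 < m) (hσ : 1 ≤ σ) (hl : 0 < l)
    (hlh : l ≤ h) (hh : h ≤ σ * l) (hA : 0 ≤ A) (hW : 0 ≤ W)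
    (H : m * (l^k * (k.factorial : ℝ)⁻¹ * z)^2 ≤ l⁻¹ * (2 * W + 2 * (l^(2*p+2) * A))) :
    |z| ≤ (p.factorial * σ^(p+1) * Real.sqrt (2/m)) / h^k *
      (h^(p+1) * (1 + 1 / Real.sqrt h) * Real.sqrt A + (1 / Real.sqrt h) * Real.sqrt W) := by
  have hh0 : 0 < h := by linarith
  have hs : 0 < Real.sqrt h := Real.sqrt_pos.2 hh0
  have step : |z| ≤ (p.factorial * σ^(p+1) * Real.sqrt (2/m)) / h^k *
      (1 / Real.sqrt h * (h^(p+1) * Real.sqrt A + Real.sqrt W)) := by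
    apply abs_le_of_sq_le_sq _ (by positivity)
    have e1 : z^2 ≤ (k.factorial : ℝ)^2 * (2/m) * ((l^k)^2)⁻¹ * l⁻¹ * (l^(2*p+2) * A + W) := by
      have hf : (0:ℝ) < k.factorial := by exact_mod_cast k.factorial_pos
      have : z^2 = (k.factorial : ℝ)^2 * m⁻¹ * ((l^k)^2)⁻¹ *
        (m * (l^k * (k.factorial : ℝ)⁻¹ * z)^2) := by field_simp
      rw [this]
      calc _ ≤ (k.factorial : ℝ)^2 * m⁻¹ * ((l^k)^2)⁻¹ *
          (l⁻¹ * (2 * W + 2 * (l^(2*p+2) * A))) := by gcongr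
        _ = _ := by ring
    have e2 : (l^k)⁻¹ ≤ σ^p * (h^k)⁻¹ := by
      have : h^k ≤ σ^p * l^k := by
        calc h^k ≤ (σ*l)^k := by gcongr
          _ = σ^k * l^k := by ring
          _ ≤ σ^p * l^k := by gcongr
      rw [inv_le_iff_one_le_mul₀ (by positivity)]
      rw [show σ^p * (h^k)⁻¹ * l^k = σ^p * l^k / h^k by ring, le_div_iff₀ (by positivity)]
      linarith
    have e3 : l⁻¹ ≤ σ^2 * h⁻¹ := by
      rw [inv_le_iff_one_le_mul₀ (by positivity)]
      rw [show σ^2 * h⁻¹ * l = σ * (σ * l) / h by ring, le_div_iff₀ (by positivity)]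
      nlinarith
    have e4 : (k.factorial : ℝ) ≤ p.factorial := by exact_mod_cast Nat.factorial_le hk
    have e5 : l^(2*p+2) * A + W ≤ (h^(p+1) * Real.sqrt A + Real.sqrt W)^2 := by
      have : l^(2*p+2) ≤ h^(2*p+2) := by gcongr
      have h3 : 0 ≤ h^(p+1) * Real.sqrt A * Real.sqrt W := by positivity
      calc _ ≤ h^(2*p+2) * A + W := by gcongr
        _ = h^(2*p+2) * (Real.sqrt A)^2 + (Real.sqrt W)^2 := by
          rw [Real.sq_sqrt hA, Real.sq_sqrt hW]
        _ ≤ h^(2*p+2) * (Real.sqrt A)^2 + (Real.sqrt W)^2 +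
            2 * (h^(p+1) * Real.sqrt A * Real.sqrt W) := by linarith
        _ = _ := by ring
    refine e1.trans ?_
    rw [← inv_pow]
    calc (k.factorial : ℝ)^2 * (2/m) * ((l^k)⁻¹)^2 * l⁻¹ * (l^(2*p+2) * A + W)
        ≤ (p.factorial : ℝ)^2 * (2/m) * (σ^p * (h^k)⁻¹)^2 * (σ^2 * h⁻¹) *
          (h^(p+1) * Real.sqrt A + Real.sqrt W)^2 := by gcongr
      _ = (p.factorial : ℝ)^2 * (Real.sqrt (2/m))^2 * (σ^p * (h^k)⁻¹)^2 *
          (σ^2 * ((Real.sqrt h)^2)⁻¹) *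
          (h^(p+1) * Real.sqrt A + Real.sqrt W)^2 := by
          rw [Real.sq_sqrt hh0.le, Real.sq_sqrt (by positivity)]
      _ = _ := by ring
  refine step.trans ?_
  have h3 : 0 ≤ h^(p+1) * Real.sqrt A := by positivity
  gcongr
  nlinarith

/-- Interior estimate (Theorem 3.2, `s = 2` case, elementwise form): the difference of
the `k`-th derivatives of `u^R` and `u` at any point of an element `[x_i, x_{i+1}]` is
controlled by local `L²` quantities. -/
theorem interior_derivative_difference_bound_l2 (p : ℕ) (σ : ℝ) (hσ : 1 ≤ σ) :
    ∃ C : ℝ, 0 < C ∧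
      ∀ (N : ℕ), 1 ≤ N → ∀ (a b : ℝ), a < b →
      ∀ (x : ℕ → ℝ), x 0 = a → x (N + 1) = b → (∀ i ≤ N, x i < x (i + 1)) →
      meshH N x ≤ σ * meshHmin N x →
      ∀ (P : ℕ → Polynomial ℝ), (∀ i ≤ N, (P i).natDegree ≤ p) →
      ∀ (u : ℝ → ℝ), ContDiffOn ℝ (p + 1 : ℕ) u (Set.Icc a b) →
      ∀ i ≤ N, ∀ xm ∈ Set.Icc (x i) (x (i + 1)), ∀ k ≤ p,
      |(Polynomial.derivative^[k] (P i)).eval xm - iteratedDerivWithin k u (Set.Icc a b) xm| ≤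
        C / meshH N x ^ k *
          (meshH N x ^ (p + 1) * (1 + 1 / Real.sqrt (meshH N x)) *
              Real.sqrt (∫ t in (x i)..(x (i + 1)),
                (iteratedDerivWithin (p + 1) u (Set.Icc a b) t) ^ 2)
            + (1 / Real.sqrt (meshH N x)) *
              Real.sqrt (∫ t in (x i)..(x (i + 1)), (u t - (P i).eval t) ^ 2)) := by
  obtain ⟨m, hm, H⟩ := aux_local p
  refine ⟨p.factorial * σ^(p+1) * Real.sqrt (2/m), by positivity, ?_⟩
  intro N hN a b hab x hx0 hxN hx hq P hP u hu i hi xm hxm k hk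
  have hmono : ∀ n, n ≤ N + 1 → ∀ j, j ≤ n → x j ≤ x n := by
    intro n
    induction n with
    | zero => intro _ j hj; simp [Nat.le_zero.1 hj]
    | succ n ih =>
      intro hn j hj
      rcases Nat.lt_or_ge j (n+1) with h | h
      · exact (ih (by omega) j (by omega)).trans (hx n (by omega)).le
      · rw [le_antisymm hj h]
  have hac : a ≤ x i := hx0 ▸ hmono i (by omega) 0 (by omega)
  have hdb : x (i+1) ≤ b := hxN ▸ hmono (N+1) le_rfl (i+1) (by omega)
  have hcd := hx i hi
  have hsub : Set.Icc (x i) (x (i+1)) ⊆ Set.Icc a b := Set.Icc_subset_Icc hac hdb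
  have hmem : i ∈ Finset.range (N+1) := Finset.mem_range.2 (by omega)
  have hle : x (i+1) - x i ≤ meshH N x :=
    Finset.le_sup' (fun i => x (i + 1) - x i) hmem
  have hge : meshHmin N x ≤ x (i+1) - x i :=
    Finset.inf'_le (fun i => x (i + 1) - x i) hmem
  have hh : meshH N x ≤ σ * (x (i+1) - x i) := hq.trans (by gcongr)
  have hud := uniqueDiffOn_Icc hab
  have hPc : ContDiffOn ℝ (p+1:ℕ) (fun t => (P i).eval t) (Set.Icc a b) :=
    (aux_cd (P i)).contDiffOn
  have hD : ∀ j ≤ p + 1, ∀ t ∈ Set.Icc a b,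
      iteratedDerivWithin j (u - fun t => (P i).eval t) (Set.Icc a b) t =
      iteratedDerivWithin j u (Set.Icc a b) t - (Polynomial.derivative^[j] (P i)).eval t := by
    intro j hj t ht
    rw [iteratedDerivWithin_sub ht hud ((hu.of_le (by exact_mod_cast hj)) t ht)
      ((hPc.of_le (by exact_mod_cast hj)) t ht), aux_poly _ _ hab ht]
  have key := H hcd hac hdb (w := u - fun t => (P i).eval t) (hu.sub hPc) hxm k hk
  have eA : ∫ r in (x i)..(x (i+1)),
        (iteratedDerivWithin (p+1) (u - fun t => (P i).eval t) (Set.Icc a b) r)^2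
      = ∫ r in (x i)..(x (i+1)), (iteratedDerivWithin (p+1) u (Set.Icc a b) r)^2 := by
    apply intervalIntegral.integral_congr
    intro r hr
    rw [Set.uIcc_of_le hcd.le] at hr
    simp only
    rw [hD _ le_rfl r (hsub hr),
      Polynomial.iterate_derivative_eq_zero (Nat.lt_succ_of_le (hP i hi))]
    simp
  rw [eA, hD k (by omega) xm (hsub hxm)] at key
  rw [abs_sub_comm]
  exact aux_final hk hm hσ (by linarith) hle hh
    (intervalIntegral.integral_nonneg hcd.le fun _ _ => sq_nonneg _)
    (intervalIntegral.integral_nonneg hcd.le fun _ _ => sq_nonneg _) key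

end
end

section
/- For every σ ≥ 1 there exists a constant C > 0 depending only on p and σ such that the following holds: for every σ-quasi-uniform partition of [a,b], every piecewise polynomial u^R = (P₀,…,P_N) of degree ≤ p with respect to it, every function u that is (p+1)-times continuously differentiable on [a,b], and every constant K ≥ 0, if ‖u − u^R‖_{L²(a,b)} ≤ K h^{p+1}, then Σ_{i=1}^{N} h ‖D_i‖² ≤ C (K + |u|_{H^{p+1}})². (That is, optimal-order L² convergence implies W^{p+1}_2 numerical smoothness of Type A.) -/
open MeasureTheory

noncomputable section

lemma aux_normequiv (p : ℕ) : ∃ A : ℝ, 0 < A ∧ ∀ v : Fin (p+1) → ℝ, ∀ k,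
    (v k)^2 ≤ A * ∫ s in (0:ℝ)..1, (∑ i, v i * s ^ (i:ℕ))^2 := by
  set F : (Fin (p+1) → ℝ) → ℝ := fun v => ∫ s in (0:ℝ)..1, (∑ i, v i * s ^ (i:ℕ))^2 with hF
  have hcont : Continuous F := by
    apply intervalIntegral.continuous_parametric_intervalIntegral_of_continuous'
    unfold Function.uncurry
    fun_prop
  obtain ⟨v0, hv0, hmin⟩ := (isCompact_sphere (0 : Fin (p+1) → ℝ) 1).exists_isMinOn
    (NormedSpace.sphere_nonempty.mpr zero_le_one) hcont.continuousOn
  have hpos : 0 < F v0 := by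
    apply intervalIntegral.integral_pos zero_lt_one
    · fun_prop
    · intros; positivity
    · by_contra! hcon
      have hz : ∀ c ∈ Set.Icc (0:ℝ) 1, (∑ i, v0 i * c ^ (i:ℕ)) = 0 := by
        intro c hc
        have := hcon c hc
        exact pow_eq_zero_iff (two_ne_zero) |>.1 (le_antisymm this (sq_nonneg _))
      let q : Polynomial ℝ := ∑ i : Fin (p+1), Polynomial.C (v0 i) * Polynomial.X ^ (i:ℕ)
      have hq : q = 0 := by
        apply Polynomial.eq_zero_of_infinite_isRoot
        apply (Set.Icc_infinite (zero_lt_one (α := ℝ))).mono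
        intro c hc
        simp only [Set.mem_ofPred_eq, Polynomial.IsRoot.def, q, Polynomial.eval_finsetSum]
        simpa using hz c hc
      have : v0 = 0 := by
        ext k
        have h1 : q.coeff k = v0 k := by
          simp only [q, Polynomial.finsetSum_coeff, Polynomial.coeff_C_mul, Polynomial.coeff_X_pow]
          rw [Finset.sum_eq_single k] 
          · simp
          · intro b _ hb
            have : (k:ℕ) ≠ b := fun h => hb (Fin.ext h.symm)
            simp [this]
          · simp
        rw [← h1, hq]; simp
      rw [this] at hv0
      simp at hv0
  refine ⟨(F v0)⁻¹, inv_pos.2 hpos, fun v k => ?_⟩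
  change _ ≤ _ * F v
  rw [inv_mul_eq_div, le_div_iff₀ hpos]
  by_cases hv : v = 0
  · subst hv
    simp [hF]
  have hn : 0 < ‖v‖ := norm_pos_iff.2 hv
  have h1 : F v0 ≤ F (‖v‖⁻¹ • v) := hmin (by simp [norm_smul, hn.ne'])
  have h2 : F (‖v‖⁻¹ • v) = (‖v‖⁻¹)^2 * F v := by
    simp only [hF]
    rw [← intervalIntegral.integral_const_mul]
    congr 1; ext s
    rw [← mul_pow, Finset.mul_sum]
    simp [mul_assoc]
  rw [h2, inv_pow, inv_mul_eq_div, le_div_iff₀ (by positivity)] at h1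
  have h3 : (v k)^2 ≤ ‖v‖^2 := by
    rw [← sq_abs]
    have := norm_le_pi_norm v k
    rw [Real.norm_eq_abs] at this
    gcongr
  nlinarith

lemma aux_inv_s10 (p : ℕ) : ∃ A : ℝ, 0 < A ∧ ∀ q : Polynomial ℝ, q.natDegree ≤ p → ∀ c l : ℝ, l ≠ 0 →
    ∀ k ≤ p, ((Polynomial.derivative^[k] q).eval c)^2 * l^(2*k) ≤
      A * (l⁻¹ * ∫ t in c..(c+l), (q.eval t)^2) := by
  obtain ⟨A, hA, h⟩ := aux_normequiv p
  refine ⟨(p.factorial:ℝ)^2 * A, by positivity, fun q hq c l hl k hk => ?_⟩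
  have h1 := h (fun i => (Polynomial.taylor c q).coeff i * l^(i:ℕ)) ⟨k, by omega⟩
  have h2 : ∀ s : ℝ, (∑ i : Fin (p+1), (Polynomial.taylor c q).coeff i * l^(i:ℕ) * s^(i:ℕ)) 
      = q.eval (c + l * s) := by
    intro s
    rw [add_comm c, ← Polynomial.taylor_eval,
      Polynomial.eval_eq_sum_range' (n := p+1) (by rw [Polynomial.natDegree_taylor]; omega),
      Finset.sum_range]
    simp [mul_pow, mul_assoc]
  simp only [h2] at h1
  rw [intervalIntegral.integral_comp_add_mul (fun t => (q.eval t)^2) hl] at h1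
  simp only [mul_zero, add_zero, mul_one, smul_eq_mul] at h1
  have h3 : (Polynomial.derivative^[k] q).eval c = k.factorial * (Polynomial.taylor c q).coeff k := by
    rw [Polynomial.taylor_coeff, ← Polynomial.factorial_smul_hasseDeriv]
    simp
  have h4 : (k.factorial:ℝ) ≤ p.factorial := by exact_mod_cast Nat.factorial_le hk
  rw [h3]
  calc _ = (k.factorial:ℝ)^2 * ((Polynomial.taylor c q).coeff k * l^k)^2 := by ring
    _ ≤ (p.factorial:ℝ)^2 * ((Polynomial.taylor c q).coeff k * l^k)^2 := by gcongr
    _ ≤ (p.factorial:ℝ)^2 * (A * (l⁻¹ * ∫ t in c..(c+l), (q.eval t)^2)) := by gcongr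
    _ = _ := by ring

lemma aux_inv2 (p : ℕ) : ∃ A : ℝ, 0 < A ∧ ∀ q : Polynomial ℝ, q.natDegree ≤ p → ∀ α β : ℝ, α < β →
    ∀ k ≤ p, ((Polynomial.derivative^[k] q).eval α)^2 * (β-α)^(2*k+1) ≤
      A * (∫ t in α..β, (q.eval t)^2) ∧ ((Polynomial.derivative^[k] q).eval β)^2 * (β-α)^(2*k+1) ≤
      A * (∫ t in α..β, (q.eval t)^2) := by
  obtain ⟨A, hA, h⟩ := aux_inv_s10 p
  refine ⟨A, hA, fun q hq α β hab k hk => ?_⟩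
  have hl : 0 < β - α := sub_pos.2 hab
  constructor
  · have := h q hq α (β-α) hl.ne' k hk
    rw [add_sub_cancel] at this
    have := mul_le_mul_of_nonneg_left this hl.le
    field_simp at this
    calc _ = _ := by ring
      _ ≤ _ := this
  · have := h q hq β (-(β-α)) (neg_ne_zero.2 hl.ne') k hk
    rw [show β + -(β-α) = α by ring, intervalIntegral.integral_symm, Even.neg_pow (by simp), 
      inv_neg, neg_mul_neg] at this
    have := mul_le_mul_of_nonneg_left this hl.le
    field_simp at this
    calc _ = _ := by ring
      _ ≤ _ := this

lemma aux_antideriv (p : ℕ) (T : Polynomial ℝ) (hT : T.natDegree ≤ p) :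
    ∃ Q : Polynomial ℝ, Q.natDegree ≤ p+1 ∧ Polynomial.derivative Q = T := by
  refine ⟨∑ i ∈ Finset.range (p+1), Polynomial.C (T.coeff i / (i+1)) * Polynomial.X^(i+1), ?_, ?_⟩
  · apply Polynomial.natDegree_sum_le_of_forall_le
    intro i hi
    have := Finset.mem_range.1 hi
    exact (Polynomial.natDegree_C_mul_X_pow_le _ _).trans (by omega)
  · conv_rhs => rw [Polynomial.as_sum_range' T (p+1) (by omega)]
    rw [Polynomial.derivative_sum]
    refine Finset.sum_congr rfl fun i _ => ?_
    rw [Polynomial.derivative_C_mul_X_pow, ← Polynomial.C_mul_X_pow_eq_monomial]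
    have : (i:ℝ) + 1 ≠ 0 := by positivity
    push_cast
    rw [div_mul_cancel₀ _ this]
    try simp

lemma aux_taylor_s10 {a b α β : ℝ} (hab : a < b) (ha : a ≤ α) (hαβ : α ≤ β) (hb : β ≤ b) (p : ℕ) :
    ∀ u : ℝ → ℝ, ContDiffOn ℝ (p + 1 : ℕ) u (Set.Icc a b) →
    ∃ T : Polynomial ℝ, T.natDegree ≤ p ∧ ∀ t ∈ Set.Icc α β, |u t - T.eval t| ≤
      (β-α)^p * ∫ s in α..β, |iteratedDerivWithin (p+1) u (Set.Icc a b) s| := by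
  have hsub : Set.Icc α β ⊆ Set.Icc a b := Set.Icc_subset_Icc ha hb
  have hud := uniqueDiffOn_Icc hab
  induction p with
  | zero =>
    intro u hu
    refine ⟨Polynomial.C (u α), by simp, fun t ht => ?_⟩
    have hd := hu.differentiableOn (by simp)
    have hc : ContinuousOn (iteratedDerivWithin 1 u (Set.Icc a b)) (Set.Icc α β) :=
      (hu.continuousOn_iteratedDerivWithin (by simp) hud).mono hsub
    have hi : IntervalIntegrable (iteratedDerivWithin 1 u (Set.Icc a b)) volume α β :=
      hc.intervalIntegrable_of_Icc hαβ
    have hi' : IntervalIntegrable (iteratedDerivWithin 1 u (Set.Icc a b)) volume α t :=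
      (hc.mono (Set.Icc_subset_Icc le_rfl ht.2)).intervalIntegrable_of_Icc ht.1
    have hftc : ∫ s in α..t, iteratedDerivWithin 1 u (Set.Icc a b) s = u t - u α := by
      apply intervalIntegral.integral_eq_sub_of_hasDeriv_right_of_le ht.1
      · exact (hu.continuousOn.mono hsub).mono (Set.Icc_subset_Icc le_rfl ht.2)
      · intro y hy
        have hy' : y ∈ Set.Ioo a b := ⟨ha.trans_lt hy.1, hy.2.trans_le (ht.2.trans hb)⟩
        have h1 := (hd y (Set.Ioo_subset_Icc_self hy')).hasDerivWithinAt
        rw [iteratedDerivWithin_one]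
        exact (h1.hasDerivAt (Icc_mem_nhds hy'.1 hy'.2)).hasDerivWithinAt
      · exact hi'
    simp only [Polynomial.eval_C, pow_zero, one_mul, zero_add]
    rw [← hftc]
    refine (intervalIntegral.abs_integral_le_integral_abs ht.1).trans ?_
    exact intervalIntegral.integral_mono_interval le_rfl ht.1 ht.2
      (Filter.Eventually.of_forall fun _ => abs_nonneg _) hi.abs
  | succ p ih =>
    intro u hu
    have hd := hu.differentiableOn (by simp)
    obtain ⟨T1, hT1, hb1⟩ := ih (derivWithin u (Set.Icc a b))
      (hu.derivWithin hud (by push_cast; rfl))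
    obtain ⟨Q, hQ, hQd⟩ := aux_antideriv p T1 hT1
    refine ⟨Q + Polynomial.C (u α - Q.eval α), ?_, fun t ht => ?_⟩
    · exact (Polynomial.natDegree_add_C).le.trans hQ
    · simp only [← iteratedDerivWithin_succ'] at hb1
      set M := ∫ s in α..β, |iteratedDerivWithin (p + 1 + 1) u (Set.Icc a b) s| with hM
      have hM0 : 0 ≤ M := intervalIntegral.integral_nonneg hαβ fun _ _ => abs_nonneg _
      have key := Convex.norm_image_sub_le_of_norm_hasDerivWithin_le 
        (f := fun y => u y - Q.eval y) (f' := fun y => derivWithin u (Set.Icc a b) y - T1.eval y)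
        (s := Set.Icc α β) (x := α) (y := t) (C := (β-α)^p * M)
        (fun y hy => by
          have h1 := ((hd y (hsub hy)).hasDerivWithinAt).mono hsub
          have h2 := (Q.hasDerivAt y).hasDerivWithinAt (s := Set.Icc α β)
          rw [hQd] at h2
          exact h1.sub h2)
        (fun y hy => hb1 y hy) (convex_Icc _ _) (Set.left_mem_Icc.2 hαβ) ht
      simp only [Polynomial.eval_add, Polynomial.eval_C]
      rw [Real.norm_eq_abs, Real.norm_eq_abs, abs_of_nonneg (by linarith [ht.1] : 0 ≤ t - α)] at key
      have h0 : 0 ≤ β - α := sub_nonneg.2 hαβ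
      calc _ = |u t - Q.eval t - (u α - Q.eval α)| := by congr 1; ring
        _ ≤ (β-α)^p * M * (t - α) := key
        _ ≤ (β-α)^p * M * (β - α) := by gcongr; exact ht.2
        _ = _ := by ring

lemma aux_cs_s10 {α β : ℝ} (h : α < β) (g : ℝ → ℝ) (hg : ContinuousOn g (Set.Icc α β)) :
    (∫ s in α..β, |g s|)^2 ≤ (β-α) * ∫ s in α..β, (g s)^2 := by
  set I := ∫ s in α..β, |g s|
  have hl : 0 < β - α := sub_pos.2 h
  have hi : IntervalIntegrable (fun s => |g s|) volume α β :=
    (hg.abs).intervalIntegrable_of_Icc h.le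
  have hi2 : IntervalIntegrable (fun s => (g s)^2) volume α β :=
    (hg.pow 2).intervalIntegrable_of_Icc h.le
  set m := I / (β-α)
  have h1 : ∫ s in α..β, 2 * m * |g s| ≤ ∫ s in α..β, ((g s)^2 + m^2) := by
    apply intervalIntegral.integral_mono_on h.le (hi.const_mul _)
      (hi2.add intervalIntegrable_const)
    intro y _
    nlinarith [sq_nonneg (|g y| - m), sq_abs (g y)]
  rw [intervalIntegral.integral_const_mul, intervalIntegral.integral_add hi2 intervalIntegrable_const,
    intervalIntegral.integral_const, smul_eq_mul] at h1
  change 2 * m * I ≤ _ at h1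
  have hm : I = m * (β-α) := by simp only [m]; field_simp
  rw [hm] at h1 ⊢
  nlinarith

lemma aux_side_s10 {α β h B' : ℝ} (hαβ : α < β) (hlen : β - α ≤ h) (u : ℝ → ℝ)
    (P T : Polynomial ℝ) (hu : ContinuousOn u (Set.Icc α β)) (hB : 0 ≤ B')
    (hT : ∀ t ∈ Set.Icc α β, (u t - T.eval t)^2 ≤ B') :
    ∫ t in α..β, ((P - T).eval t)^2 ≤ 2 * (∫ t in α..β, (u t - P.eval t)^2) + 2 * (h * B') := by
  have hi : IntervalIntegrable (fun t => (u t - P.eval t)^2) volume α β :=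
    ((hu.sub P.continuous.continuousOn).pow 2).intervalIntegrable_of_Icc hαβ.le
  have h1 : ∫ t in α..β, ((P - T).eval t)^2 ≤ ∫ t in α..β, (2 * (u t - P.eval t)^2 + 2 * B') := by
    apply intervalIntegral.integral_mono_on hαβ.le
      ((((P-T).continuous).pow 2).intervalIntegrable _ _) ((hi.const_mul _).add intervalIntegrable_const)
    intro t ht
    have := hT t ht
    change ((P - T).eval t)^2 ≤ _
    rw [Polynomial.eval_sub]
    nlinarith [sq_nonneg ((u t - P.eval t) + (u t - T.eval t))]
  rw [intervalIntegral.integral_add (hi.const_mul _) intervalIntegrable_const,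
    intervalIntegral.integral_const_mul, intervalIntegral.integral_const, smul_eq_mul] at h1
  nlinarith

lemma aux_local_s10 (p : ℕ) (σ : ℝ) (hσ : 1 ≤ σ) : ∃ A : ℝ, 0 < A ∧
    ∀ a b α γ β h : ℝ, a ≤ α → α < γ → γ < β → β ≤ b → γ - α ≤ h → β - γ ≤ h →
    h ≤ σ * (γ - α) → h ≤ σ * (β - γ) → ∀ P Q : Polynomial ℝ, P.natDegree ≤ p → Q.natDegree ≤ p →
    ∀ u : ℝ → ℝ, ContDiffOn ℝ (p + 1 : ℕ) u (Set.Icc a b) → ∀ k ≤ p,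
    ((Polynomial.derivative^[k] Q).eval γ - (Polynomial.derivative^[k] P).eval γ)^2 * h^(2*k+1) ≤
    A * ((∫ t in α..γ, (u t - P.eval t)^2) + (∫ t in γ..β, (u t - Q.eval t)^2) +
      2^(2*p+2) * h^(2*p+2) * ∫ t in α..β, (iteratedDerivWithin (p+1) u (Set.Icc a b) t)^2) := by
  obtain ⟨A, hA, hinv⟩ := aux_inv2 p
  refine ⟨4 * A * σ^(2*p+1), by positivity, ?_⟩
  intro a b α γ β h haα hαγ hγβ hβb h1 h2 h3 h4 P Q hP hQ u hu k hk
  have hh : 0 < h := by linarith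
  have hab : a < b := by linarith
  have hαβ : α < β := by linarith
  obtain ⟨T, hT, hTb⟩ := aux_taylor_s10 hab haα hαβ.le hβb p u hu
  have hsub : Set.Icc α β ⊆ Set.Icc a b := Set.Icc_subset_Icc haα hβb
  have hg : ContinuousOn (iteratedDerivWithin (p+1) u (Set.Icc a b)) (Set.Icc α β) :=
    (hu.continuousOn_iteratedDerivWithin le_rfl (uniqueDiffOn_Icc hab)).mono hsub
  have hcs := aux_cs_s10 hαβ _ hg
  set S := ∫ t in α..β, (iteratedDerivWithin (p+1) u (Set.Icc a b) t)^2 with hS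
  set I := ∫ t in α..β, |iteratedDerivWithin (p+1) u (Set.Icc a b) t| with hI
  have hS0 : 0 ≤ S := intervalIntegral.integral_nonneg hαβ.le fun _ _ => sq_nonneg _
  have hl : 0 < β - α := by linarith
  have hTb2 : ∀ t ∈ Set.Icc α β, (u t - T.eval t)^2 ≤ (2*h)^(2*p+1) * S := by
    intro t ht
    calc (u t - T.eval t)^2 = |u t - T.eval t|^2 := (sq_abs _).symm
      _ ≤ ((β-α)^p * I)^2 := by gcongr; exact hTb t ht
      _ = (β-α)^(2*p) * I^2 := by ring
      _ ≤ (β-α)^(2*p) * ((β-α) * S) := by gcongr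
      _ = (β-α)^(2*p+1) * S := by ring
      _ ≤ (2*h)^(2*p+1) * S := by gcongr; linarith
  have hB0 : 0 ≤ (2*h)^(2*p+1) * S := by positivity
  have hs1 := aux_side_s10 hαγ h1 u P T
    (hu.continuousOn.mono ((Set.Icc_subset_Icc le_rfl hγβ.le).trans hsub)) hB0
    (fun t ht => hTb2 t ⟨ht.1, ht.2.trans hγβ.le⟩)
  have hs2 := aux_side_s10 hγβ h2 u Q T
    (hu.continuousOn.mono ((Set.Icc_subset_Icc hαγ.le le_rfl).trans hsub)) hB0
    (fun t ht => hTb2 t ⟨hαγ.le.trans ht.1, ht.2⟩)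
  have hi1 := (hinv (P - T) ((Polynomial.natDegree_sub_le _ _).trans (max_le hP hT)) α γ hαγ k hk).2
  have hi2 := (hinv (Q - T) ((Polynomial.natDegree_sub_le _ _).trans (max_le hQ hT)) γ β hγβ k hk).1
  have scale : ∀ l X Y : ℝ, 0 < l → h ≤ σ * l → X^2 * l^(2*k+1) ≤ A * Y →
      X^2 * h^(2*k+1) ≤ σ^(2*p+1) * (A * Y) := by
    intro l X Y hl hle hXY
    calc X^2 * h^(2*k+1) ≤ X^2 * (σ*l)^(2*k+1) := by gcongr
      _ = σ^(2*k+1) * (X^2 * l^(2*k+1)) := by ring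
      _ ≤ σ^(2*p+1) * (X^2 * l^(2*k+1)) := by gcongr
      _ ≤ _ := by gcongr
  have hj1 := scale _ _ _ (by linarith) h3 hi1
  have hj2 := scale _ _ _ (by linarith) h4 hi2
  rw [Polynomial.iterate_derivative_sub, Polynomial.eval_sub] at hj1 hj2
  set q := (Polynomial.derivative^[k] Q).eval γ
  set r := (Polynomial.derivative^[k] P).eval γ
  set w := (Polynomial.derivative^[k] T).eval γ
  have hsq : (q - r)^2 ≤ 2 * (r-w)^2 + 2*(q-w)^2 := by nlinarith [sq_nonneg ((r-w)+(q-w))]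
  set E1 := ∫ t in α..γ, (u t - P.eval t)^2
  set E2 := ∫ t in γ..β, (u t - Q.eval t)^2
  calc (q-r)^2 * h^(2*k+1) ≤ (2 * (r-w)^2 + 2*(q-w)^2) * h^(2*k+1) := by gcongr
    _ = 2 * ((r-w)^2 * h^(2*k+1)) + 2 * ((q-w)^2 * h^(2*k+1)) := by ring
    _ ≤ 2 * (σ^(2*p+1) * (A * (2 * E1 + 2 * (h * ((2*h)^(2*p+1) * S))))) +
        2 * (σ^(2*p+1) * (A * (2 * E2 + 2 * (h * ((2*h)^(2*p+1) * S))))) := by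
        refine add_le_add (mul_le_mul_of_nonneg_left (hj1.trans ?_) two_pos.le)
          (mul_le_mul_of_nonneg_left (hj2.trans ?_) two_pos.le) <;> gcongr
    _ = _ := by ring

/-- Optimal-order `L²` convergence implies `W^{p+1}_2` numerical smoothness of Type A. -/
theorem optimal_l2_convergence_implies_smoothness (p : ℕ) (σ : ℝ) (hσ : 1 ≤ σ) :
    ∃ C : ℝ, 0 < C ∧
      ∀ (N : ℕ), 1 ≤ N → ∀ (a b : ℝ), a < b →
      ∀ (x : ℕ → ℝ), x 0 = a → x (N + 1) = b → (∀ i ≤ N, x i < x (i + 1)) →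
      meshH N x ≤ σ * meshHmin N x →
      ∀ (P : ℕ → Polynomial ℝ), (∀ i ≤ N, (P i).natDegree ≤ p) →
      ∀ (u : ℝ → ℝ), ContDiffOn ℝ (p + 1 : ℕ) u (Set.Icc a b) →
      ∀ (K : ℝ), 0 ≤ K →
      distL2 N x P u ≤ K * meshH N x ^ (p + 1) →
      ∑ i ∈ Finset.Icc 1 N, meshH N x * (normD p N x P i) ^ 2 ≤
        C * (K + semiH p a b u) ^ 2 := by
  obtain ⟨A, hA, hloc⟩ := aux_local_s10 p σ hσ
  refine ⟨(p+1) * A * (2 * 2^(2*p+2)), by positivity, ?_⟩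
  intro N hN a b hab x hx0 hxN hx hqu P hP u hu K hK hdist
  set h := meshH N x with hh
  have hle : ∀ i ≤ N, x (i+1) - x i ≤ h := fun i hi =>
    Finset.le_sup' (fun i => x (i + 1) - x i) (Finset.mem_range.2 (by omega))
  have hge : ∀ i ≤ N, h ≤ σ * (x (i+1) - x i) := fun i hi =>
    hqu.trans (mul_le_mul_of_nonneg_left
      (Finset.inf'_le (fun i => x (i + 1) - x i) (Finset.mem_range.2 (by omega))) (by linarith))
  have hpos : 0 < h := by linarith [hle 0 (by omega), hx 0 (by omega)]
  have hmono : ∀ j ≤ N+1, ∀ i ≤ j, x i ≤ x j := by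
    intro j
    induction j with
    | zero => intro _ i hi; rw [Nat.le_zero.1 hi]
    | succ j ih =>
      intro hj i hi
      rcases Nat.lt_or_ge i (j+1) with h' | h'
      · exact (ih (by omega) i (by omega)).trans (hx j (by omega)).le
      · rw [le_antisymm hi h']
  have hxa : ∀ i ≤ N+1, a ≤ x i := fun i hi => hx0 ▸ hmono i hi 0 (by omega)
  have hxb : ∀ i ≤ N+1, x i ≤ b := fun i hi => hxN ▸ hmono (N+1) le_rfl i hi
  set g := iteratedDerivWithin (p+1) u (Set.Icc a b) with hg
  have hgc : ContinuousOn g (Set.Icc a b) :=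
    hu.continuousOn_iteratedDerivWithin le_rfl (uniqueDiffOn_Icc hab)
  have hgi : ∀ i ≤ N, IntervalIntegrable (fun t => (g t)^2) volume (x i) (x (i+1)) := fun i hi =>
    ((hgc.mono (Set.Icc_subset_Icc (hxa i (by omega)) (hxb (i+1) (by omega)))).pow 2
      ).intervalIntegrable_of_Icc (hx i hi).le
  set E : ℕ → ℝ := fun i => ∫ t in (x i)..(x (i + 1)), (u t - (P i).eval t) ^ 2 with hE
  set s : ℕ → ℝ := fun i => ∫ t in (x i)..(x (i + 1)), (g t) ^ 2 with hs
  have hE0 : ∀ i ≤ N, 0 ≤ E i := fun i hi =>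
    intervalIntegral.integral_nonneg (hx i hi).le fun _ _ => sq_nonneg _
  have hs0 : ∀ i ≤ N, 0 ≤ s i := fun i hi =>
    intervalIntegral.integral_nonneg (hx i hi).le fun _ _ => sq_nonneg _
  have hsumE : ∑ i ∈ Finset.range (N+1), E i ≤ K^2 * h^(2*p+2) := by
    have h0 : 0 ≤ ∑ i ∈ Finset.range (N+1), E i :=
      Finset.sum_nonneg fun i hi => hE0 i (by have := Finset.mem_range.1 hi; omega)
    have h1 : (distL2 N x P u)^2 = ∑ i ∈ Finset.range (N+1), E i := Real.sq_sqrt h0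
    rw [← h1]
    calc _ ≤ (K * h^(p+1))^2 := by
          have : 0 ≤ distL2 N x P u := Real.sqrt_nonneg _
          gcongr
      _ = _ := by ring
  have hsums : ∑ i ∈ Finset.range (N+1), s i = (semiH p a b u)^2 := by
    rw [semiH, Real.sq_sqrt (intervalIntegral.integral_nonneg hab.le fun _ _ => sq_nonneg _)]
    rw [← hx0, ← hxN]
    simp only [hs, hg]
    rw [← intervalIntegral.sum_integral_adjacent_intervals
      (fun k hk => by have := hgi k (by omega); rw [hg] at this; rwa [hx0, hxN])]
    rw [hx0, hxN]
  have hterm : ∀ i ∈ Finset.Icc 1 N, h * (normD p N x P i)^2 ≤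
      (p+1) * A * ((E (i-1) + E i) / h^(2*p+2) + 2^(2*p+2) * (s (i-1) + s i)) := by
    intro i hi
    obtain ⟨hi1, hi2⟩ := Finset.mem_Icc.1 hi
    obtain ⟨j, rfl⟩ : ∃ j, i = j+1 := ⟨i-1, by omega⟩
    simp only [Nat.add_sub_cancel]
    rw [normD, Real.sq_sqrt (Finset.sum_nonneg fun _ _ => sq_nonneg _), Finset.mul_sum]
    have hk : ∀ k ∈ Finset.range (p+1), h * (jumpD P x (j+1) k / meshH N x ^ (p + 1 - k))^2 ≤
        A * ((E j + E (j+1)) / h^(2*p+2) + 2^(2*p+2) * (s j + s (j+1))) := by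
      intro k hk
      have hk' : k ≤ p := by have := Finset.mem_range.1 hk; omega
      rw [← hh]
      have key := hloc a b (x j) (x (j+1)) (x (j+1+1)) h (hxa j (by omega)) (hx j (by omega))
        (hx (j+1) (by omega)) (hxb _ (by omega)) (hle j (by omega)) (hle (j+1) (by omega))
        (hge j (by omega)) (hge (j+1) (by omega)) (P j) (P (j+1)) (hP _ (by omega))
        (hP _ (by omega)) u hu k hk'
      rw [← intervalIntegral.integral_add_adjacent_intervals (hgi j (by omega))
        (hgi (j+1) (by omega))] at key
      change (jumpD P x (j+1) k)^2 * h^(2*k+1) ≤ A * (E j + E (j+1) + 2^(2*p+2) * h^(2*p+2)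
        * (s j + s (j+1))) at key
      have e1 : h * (jumpD P x (j+1) k / h ^ (p + 1 - k))^2 =
          ((jumpD P x (j+1) k)^2 * h^(2*k+1)) / h^(2*p+2) := by
        have : h^(2*p+2) = (h^(p+1-k))^2 * h^(2*k) := by
          rw [← pow_mul, ← pow_add]; congr 1; omega
        rw [this]
        field_simp
        ring
      have e2 : A * ((E j + E (j+1)) / h^(2*p+2) + 2^(2*p+2) * (s j + s (j+1))) =
          (A * (E j + E (j+1) + 2^(2*p+2) * h^(2*p+2) * (s j + s (j+1)))) / h^(2*p+2) := by
        field_simp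
      rw [e1, e2]
      gcongr
    refine (Finset.sum_le_sum hk).trans (le_of_eq ?_)
    rw [Finset.sum_const, Finset.card_range, nsmul_eq_mul]
    push_cast; ring
  have hshift : ∀ f : ℕ → ℝ, (∀ i ≤ N, 0 ≤ f i) →
      ∑ i ∈ Finset.Icc 1 N, (f (i-1) + f i) ≤ 2 * ∑ i ∈ Finset.range (N+1), f i := by
    intro f hf
    rw [← Finset.Ico_add_one_right_eq_Icc, Finset.sum_Ico_eq_sum_range]
    simp only [Nat.add_sub_cancel, Nat.add_sub_cancel_left, Finset.sum_add_distrib]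
    have h1 := Finset.sum_range_succ f N
    have h2 := Finset.sum_range_succ' f N
    have h3 : ∑ i ∈ Finset.range N, f (1+i) = ∑ i ∈ Finset.range N, f (i+1) :=
      Finset.sum_congr rfl fun i _ => by rw [add_comm]
    linarith [hf 0 (by omega), hf N le_rfl]
  refine (Finset.sum_le_sum hterm).trans ?_
  rw [← Finset.mul_sum, Finset.sum_add_distrib, ← Finset.sum_div, ← Finset.mul_sum]
  have f1 : (∑ i ∈ Finset.Icc 1 N, (E (i-1) + E i)) / h^(2*p+2) ≤ 2 * K^2 := by
    rw [div_le_iff₀ (by positivity)]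
    linarith [hshift E hE0]
  have f2 := hshift s hs0
  rw [hsums] at f2
  have hH : 0 ≤ semiH p a b u := Real.sqrt_nonneg _
  rw [mul_assoc ((p+1:ℝ) * A)]
  refine mul_le_mul_of_nonneg_left ?_ (by positivity)
  have hB : (1:ℝ) ≤ 2^(2*p+2) := one_le_pow₀ (by norm_num)
  calc _ ≤ 2 * K^2 + 2^(2*p+2) * (2 * (semiH p a b u)^2) := by gcongr
    _ ≤ 2^(2*p+2) * (2 * K^2) + 2^(2*p+2) * (2 * (semiH p a b u)^2) := by
        nlinarith [sq_nonneg K]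
    _ = 2 * 2^(2*p+2) * (K^2 + (semiH p a b u)^2) := by ring
    _ ≤ 2 * 2^(2*p+2) * (K + semiH p a b u)^2 := by
        gcongr
        nlinarith [mul_nonneg hK hH]

end
end
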